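/- arXiv:2212.14610 — 7 statements merged into one kernel-verified Lean document; each statement's English description precedes it below -/
import Mathlib

section
/- (Rota's Galois Connection Theorem.) Let P and Q be finite posets, m : P → ℤ and n : Q → ℤ functions, and f : P ⇄ Q : g a Galois connection. If n = m ∘ g, then ∂n = f_♯(∂m); that is, for every x ∈ Q, ∂n(x) = Σ_{a ∈ f⁻¹(x)} ∂m(a), with the empty sum interpreted as 0. -/
set_option linter.unusedSectionVars false
set_option linter.unusedVariables false

open Classical

/-- The poset `Int P` of intervals `[a, b]` of a poset `P` (encoded as pairs `a ≤ b`),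
equipped with the product ordering `[a,b] ≤ [c,d] ↔ a ≤ c ∧ b ≤ d`. -/
abbrev Itv (P : Type*) [PartialOrder P] : Type _ := {p : P × P // p.1 ≤ p.2}

/-- `dm` is the Möbius inversion `∂m` of `m`: the unique function satisfying
`m y = ∑_{x ≤ y} dm x` for all `y` in the finite poset `R`. -/
def IsMobiusInv {R : Type*} [PartialOrder R] [Fintype R] (m dm : R → ℤ) : Prop :=
  ∀ y : R, m y = ∑ x : R, if x ≤ y then dm x else 0


/-- **Rota's Galois Connection Theorem**: if `f : P ⇄ Q : g` is a Galois connection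
between finite posets and `n = m ∘ g`, then `∂n = f_♯(∂m)`, i.e.
`∂n(x) = ∑_{a ∈ f⁻¹(x)} ∂m(a)`. -/
theorem rota_galois_connection {P Q : Type*} [PartialOrder P] [PartialOrder Q]
    [Fintype P] [Fintype Q]
    (f : P → Q) (g : Q → P) (hgc : GaloisConnection f g)
    (m : P → ℤ) (n : Q → ℤ) (dm : P → ℤ) (dn : Q → ℤ)
    (hm : IsMobiusInv m dm) (hn : IsMobiusInv n dn)
    (h : n = m ∘ g) :
    ∀ x : Q, dn x = ∑ a : P, if f a = x then dm a else 0 := by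
  have key : IsMobiusInv n (fun x => ∑ a : P, if f a = x then dm a else 0) := by
    intro y
    have h1 : n y = ∑ a : P, if f a ≤ y then dm a else 0 := by
      rw [h, Function.comp_apply, hm (g y)]
      refine Finset.sum_congr rfl fun a _ => ?_
      exact if_congr (hgc a y).symm rfl rfl
    have h2 : ∀ x : Q, (if x ≤ y then (∑ a : P, if f a = x then dm a else 0) else 0)
        = ∑ a : P, if f a = x then (if f a ≤ y then dm a else 0) else 0 := by
      intro x
      by_cases hx : x ≤ y
      · rw [if_pos hx]
        refine Finset.sum_congr rfl fun a _ => ?_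
        by_cases ha : f a = x
        · subst ha
          simp [hx]
        · simp [ha]
      · rw [if_neg hx]
        symm
        refine Finset.sum_eq_zero fun a _ => ?_
        by_cases ha : f a = x
        · subst ha
          simp [hx]
        · simp [ha]
    rw [h1]
    simp only [h2]
    rw [Finset.sum_comm]
    refine Finset.sum_congr rfl fun a _ => ?_
    rw [Finset.sum_ite_eq, if_pos (Finset.mem_univ _)]
  intro x
  induction x using (wellFounded_lt (α := Q)).induction with
  | _ x ih =>
    have e := (hn x).symm.trans (key x)
    rw [← Finset.add_sum_erase _ _ (Finset.mem_univ x),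
      ← Finset.add_sum_erase Finset.univ
        (fun z => if z ≤ x then (∑ a : P, if f a = z then dm a else 0) else 0)
        (Finset.mem_univ x)] at e
    have e2 : ∑ z ∈ Finset.univ.erase x, (if z ≤ x then dn z else 0)
        = ∑ z ∈ Finset.univ.erase x,
          (if z ≤ x then (∑ a : P, if f a = z then dm a else 0) else 0) := by
      refine Finset.sum_congr rfl fun z hz => ?_
      by_cases hzx : z ≤ x
      · rw [if_pos hzx, if_pos hzx]
        exact ih z (lt_of_le_of_ne hzx (Finset.ne_of_mem_erase hz))
      · rw [if_neg hzx, if_neg hzx]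
    rw [e2] at e
    have e3 := add_right_cancel e
    simpa only [le_refl, if_true] using e3
end

section
/- Let F : P → ΔK be a filtration of a finite simplicial complex K indexed by a finite poset P, with simplicial chains over a field 𝔽. Let H_d F : P → Vect_𝔽 be its d-th homology persistence module, H_d F(a) = Z_d F(a)/B_d F(a) with maps induced by inclusion, and let ker H_d F : Int P → ℤ be its kernel function, ker H_d F[a,b] = dim ker(H_d F(a) → H_d F(b)). Then the Möbius inversions ∂BD_d F and ∂(ker H_d F) agree away from the diagonal: ∂BD_d F[a,b] = ∂(ker H_d F)[a,b] for all a < b in P. -/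
set_option linter.unusedSectionVars false
set_option linter.unusedVariables false

open Classical

variable {V : Type*} [LinearOrder V]

/-- `K` is a finite abstract simplicial complex. -/
def IsComplex (K : Finset (Finset V)) : Prop :=
  (∀ s ∈ K, s.Nonempty) ∧ ∀ s ∈ K, ∀ t : Finset V, t ⊆ s → t.Nonempty → t ∈ K

/-- `A` is a subcomplex of `K`. -/
def IsSubcomplexOf (K A : Finset (Finset V)) : Prop :=
  A ⊆ K ∧ ∀ s ∈ A, ∀ t : Finset V, t ⊆ s → t.Nonempty → t ∈ A

/-- `A` is a supcomplex of `K` (closed under taking cofaces in `K`). -/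
def IsSupcomplexOf (K A : Finset (Finset V)) : Prop :=
  A ⊆ K ∧ ∀ s ∈ A, ∀ t ∈ K, s ⊆ t → t ∈ A

/-- The `d`-dimensional simplices of `A`. -/
def dsimp (A : Finset (Finset V)) (d : ℕ) : Finset (Finset V) :=
  A.filter fun s => s.card = d + 1

variable (𝔽 : Type*) [Field 𝔽]

/-- `d`-chains on `A` with coefficients in `𝔽`. -/
abbrev Chains (A : Finset (Finset V)) (d : ℕ) : Type _ := ↥(dsimp A d) → 𝔽

/-- The sign of vertex `v` in the simplex `τ`. -/
def sgn (τ : Finset V) (v : V) : 𝔽 := (-1) ^ (τ.filter fun w => w < v).card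

/-- Incidence coefficient of `σ` in the boundary of `τ`. -/
def co (τ σ : Finset V) : 𝔽 := ∑ v ∈ τ, if σ = τ.erase v then sgn 𝔽 τ v else 0

/-- Boundary operator relative to `A`: faces not in `A` are omitted. -/
noncomputable def bdry (A : Finset (Finset V)) (d : ℕ) :
    Chains 𝔽 A (d + 1) →ₗ[𝔽] Chains 𝔽 A d :=
  LinearMap.pi fun σ => ∑ τ : ↥(dsimp A (d + 1)), co 𝔽 τ.1 σ.1 • LinearMap.proj τ

/-- Coboundary operator relative to `A` (transpose of `bdry`). -/
noncomputable def cobdry (A : Finset (Finset V)) (d : ℕ) :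
    Chains 𝔽 A d →ₗ[𝔽] Chains 𝔽 A (d + 1) :=
  LinearMap.pi fun τ : ↥(dsimp A (d + 1)) =>
    ∑ v ∈ τ.1, sgn 𝔽 τ.1 v •
      (if h : τ.1.erase v ∈ dsimp A d then
        (LinearMap.proj ⟨τ.1.erase v, h⟩ : Chains 𝔽 A d →ₗ[𝔽] 𝔽) else 0)

/-- Extension by zero `C(A) → C(B)`; for subcomplex pairs it is the inclusion of chains,
and it is also the injective cochain map dual to the surjection of chains. -/
noncomputable def incl (A B : Finset (Finset V)) (d : ℕ) :
    Chains 𝔽 A d →ₗ[𝔽] Chains 𝔽 B d :=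
  LinearMap.pi fun σ : ↥(dsimp B d) =>
    if h : σ.1 ∈ dsimp A d then
      (LinearMap.proj ⟨σ.1, h⟩ : Chains 𝔽 A d →ₗ[𝔽] 𝔽) else 0

/-- Cycles. -/
noncomputable def cycles (A : Finset (Finset V)) : (d : ℕ) → Submodule 𝔽 (Chains 𝔽 A d)
  | 0 => ⊤
  | d + 1 => LinearMap.ker (bdry 𝔽 A d)

/-- Boundaries. -/
noncomputable def bounds (A : Finset (Finset V)) (d : ℕ) : Submodule 𝔽 (Chains 𝔽 A d) :=
  LinearMap.range (bdry 𝔽 A d)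

/-- Cocycles. -/
noncomputable def cocycles (A : Finset (Finset V)) (d : ℕ) : Submodule 𝔽 (Chains 𝔽 A d) :=
  LinearMap.ker (cobdry 𝔽 A d)

/-- Coboundaries. -/
noncomputable def cobounds (A : Finset (Finset V)) : (d : ℕ) → Submodule 𝔽 (Chains 𝔽 A d)
  | 0 => ⊥
  | d + 1 => LinearMap.range (cobdry 𝔽 A d)

/-- Birth-death function of a filtration: `BD_d F [a,b] = dim (Z_d F(a) ∩ B_d F(b))`. -/
noncomputable def BDh {P : Type*} [PartialOrder P] (F : P → Finset (Finset V)) (d : ℕ)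
    (I : Itv P) : ℤ :=
  Module.finrank 𝔽
    ↥((cycles 𝔽 (F I.1.1) d).map (incl 𝔽 (F I.1.1) (F I.1.2) d) ⊓ bounds 𝔽 (F I.1.2) d)

/-- Birth-death function of a cofiltration: `BD^d F [a,b] = dim (Z^d F(a) ∩ B^d F(b))`. -/
noncomputable def BDc {P : Type*} [PartialOrder P] (F : P → Finset (Finset V)) (d : ℕ)
    (I : Itv P) : ℤ :=
  Module.finrank 𝔽
    ↥((cocycles 𝔽 (F I.1.1) d).map (incl 𝔽 (F I.1.1) (F I.1.2) d) ⊓ cobounds 𝔽 (F I.1.2) d)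

lemma incl_apply (A B : Finset (Finset V)) (d : ℕ) (c : Chains 𝔽 A d) (σ : ↥(dsimp B d)) :
    incl 𝔽 A B d c σ = if h : σ.1 ∈ dsimp A d then c ⟨σ.1, h⟩ else 0 := by
  rw [incl, LinearMap.pi_apply]
  by_cases h : σ.1 ∈ dsimp A d
  · rw [dif_pos h, dif_pos h]; rfl
  · rw [dif_neg h, dif_neg h, LinearMap.zero_apply]

lemma bdry_apply (A : Finset (Finset V)) (d : ℕ) (c : Chains 𝔽 A (d+1)) (σ : ↥(dsimp A d)) :
    bdry 𝔽 A d c σ = ∑ τ : ↥(dsimp A (d+1)), co 𝔽 τ.1 σ.1 * c τ := by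
  simp [bdry, LinearMap.pi_apply, LinearMap.sum_apply, LinearMap.smul_apply, smul_eq_mul]

lemma cobdry_apply (A : Finset (Finset V)) (d : ℕ) (c : Chains 𝔽 A d) (τ : ↥(dsimp A (d+1))) :
    cobdry 𝔽 A d c τ
      = ∑ v ∈ τ.1, sgn 𝔽 τ.1 v * (if h : τ.1.erase v ∈ dsimp A d then c ⟨τ.1.erase v, h⟩ else 0) := by
  rw [cobdry, LinearMap.pi_apply, LinearMap.sum_apply]
  refine Finset.sum_congr rfl fun v hv => ?_
  rw [LinearMap.smul_apply, smul_eq_mul]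
  by_cases h : τ.1.erase v ∈ dsimp A d
  · rw [dif_pos h, dif_pos h]; rfl
  · rw [dif_neg h, dif_neg h, LinearMap.zero_apply]

lemma mem_dsimp {A : Finset (Finset V)} {t : Finset V} {d : ℕ} :
    t ∈ dsimp A d ↔ t ∈ A ∧ t.card = d + 1 := Finset.mem_filter

lemma incl_bdry_comm (A B : Finset (Finset V)) (hAB : A ⊆ B)
    (hA : ∀ s ∈ A, ∀ t : Finset V, t ⊆ s → t.Nonempty → t ∈ A) (d : ℕ) :
    (bdry 𝔽 B d).comp (incl 𝔽 A B (d + 1)) = (incl 𝔽 A B d).comp (bdry 𝔽 A d) := by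
  have hsub : dsimp A (d+1) ⊆ dsimp B (d+1) := fun t ht =>
    mem_dsimp.2 ⟨hAB (mem_dsimp.1 ht).1, (mem_dsimp.1 ht).2⟩
  refine LinearMap.ext fun c => funext fun σ => ?_
  rw [LinearMap.comp_apply, LinearMap.comp_apply, bdry_apply, incl_apply]
  simp only [incl_apply]
  by_cases hσ : σ.1 ∈ dsimp A d
  · rw [dif_pos hσ, bdry_apply]
    have e0 : ∀ τ : ↥(dsimp B (d+1)),
        co 𝔽 τ.1 σ.1 * (if h : τ.1 ∈ dsimp A (d + 1) then c ⟨τ.1, h⟩ else 0)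
          = (fun t => if h : t ∈ dsimp A (d + 1) then co 𝔽 t σ.1 * c ⟨t, h⟩ else 0) τ.1 := by
      intro τ; by_cases h : τ.1 ∈ dsimp A (d+1) <;> simp [h]
    rw [Finset.sum_congr rfl (fun τ _ => e0 τ),
      Finset.sum_coe_sort (dsimp B (d+1))
        (fun t => if h : t ∈ dsimp A (d + 1) then co 𝔽 t σ.1 * c ⟨t, h⟩ else 0),
      ← Finset.sum_subset hsub (fun t _ ht => dif_neg ht),
      ← Finset.sum_coe_sort (dsimp A (d+1))
        (fun t => if h : t ∈ dsimp A (d + 1) then co 𝔽 t σ.1 * c ⟨t, h⟩ else 0)]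
    exact Finset.sum_congr rfl fun τ _ => by rw [dif_pos τ.2]
  · rw [dif_neg hσ]
    refine Finset.sum_eq_zero fun τ _ => ?_
    by_cases h : τ.1 ∈ dsimp A (d+1)
    · rw [dif_pos h]
      have hco : co 𝔽 τ.1 σ.1 = 0 := by
        refine Finset.sum_eq_zero fun v hv => ?_
        rw [if_neg]
        intro he
        refine hσ (mem_dsimp.2 ⟨?_, (mem_dsimp.1 σ.2).2⟩)
        refine hA τ.1 (mem_dsimp.1 h).1 σ.1 ?_ ?_
        · rw [he]; exact Finset.erase_subset _ _
        · refine Finset.card_pos.1 ?_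
          rw [(mem_dsimp.1 σ.2).2]; omega
      rw [hco, zero_mul]
    · rw [dif_neg h, mul_zero]

lemma cyclesLe {A B : Finset (Finset V)} (hAB : A ⊆ B)
    (hA : ∀ s ∈ A, ∀ t : Finset V, t ⊆ s → t.Nonempty → t ∈ A) (d : ℕ) :
    cycles 𝔽 A d ≤ (cycles 𝔽 B d).comap (incl 𝔽 A B d) := by
  cases d with
  | zero => simp [cycles]
  | succ d =>
    intro c hc
    have hcomm := LinearMap.congr_fun (incl_bdry_comm 𝔽 A B hAB hA d) c
    simp only [LinearMap.comp_apply] at hcomm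
    simp only [cycles, Submodule.mem_comap, LinearMap.mem_ker] at hc ⊢
    rw [hcomm, hc, map_zero]

lemma boundsLe {A B : Finset (Finset V)} (hAB : A ⊆ B)
    (hA : ∀ s ∈ A, ∀ t : Finset V, t ⊆ s → t.Nonempty → t ∈ A) (d : ℕ) :
    bounds 𝔽 A d ≤ (bounds 𝔽 B d).comap (incl 𝔽 A B d) := by
  rintro c ⟨x, rfl⟩
  have hcomm := LinearMap.congr_fun (incl_bdry_comm 𝔽 A B hAB hA d) x
  simp only [LinearMap.comp_apply] at hcomm
  exact Submodule.mem_comap.2 ⟨incl 𝔽 A B (d+1) x, hcomm⟩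

lemma incl_cobdry_comm (A B : Finset (Finset V)) (hAB : A ⊆ B)
    (hA : ∀ s ∈ A, ∀ t ∈ B, s ⊆ t → t ∈ A) (d : ℕ) :
    (cobdry 𝔽 B d).comp (incl 𝔽 A B d) = (incl 𝔽 A B (d + 1)).comp (cobdry 𝔽 A d) := by
  have hsubd : dsimp A d ⊆ dsimp B d := fun t ht =>
    mem_dsimp.2 ⟨hAB (mem_dsimp.1 ht).1, (mem_dsimp.1 ht).2⟩
  refine LinearMap.ext fun c => funext fun τ => ?_
  rw [LinearMap.comp_apply, LinearMap.comp_apply, cobdry_apply, incl_apply]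
  by_cases hτ : τ.1 ∈ dsimp A (d+1)
  · rw [dif_pos hτ, cobdry_apply]
    refine Finset.sum_congr rfl fun v hv => ?_
    by_cases h' : τ.1.erase v ∈ dsimp A d
    · simp [incl_apply, hsubd h', h']
    · have h'' : ∀ hb : τ.1.erase v ∈ dsimp B d,
          incl 𝔽 A B d c ⟨τ.1.erase v, hb⟩ = 0 := fun hb => by
        rw [incl_apply, dif_neg h']
      by_cases h : τ.1.erase v ∈ dsimp B d
      · rw [dif_pos h, h'' h, dif_neg h']
      · rw [dif_neg h, dif_neg h']
  · rw [dif_neg hτ]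
    refine Finset.sum_eq_zero fun v hv => ?_
    by_cases h : τ.1.erase v ∈ dsimp B d
    · rw [dif_pos h, incl_apply, dif_neg, mul_zero]
      intro h'
      exact hτ (mem_dsimp.2 ⟨hA _ (mem_dsimp.1 h').1 τ.1 (mem_dsimp.1 τ.2).1
        (Finset.erase_subset _ _), (mem_dsimp.1 τ.2).2⟩)
    · rw [dif_neg h, mul_zero]

lemma cocyclesLe {A B : Finset (Finset V)} (hAB : A ⊆ B)
    (hA : ∀ s ∈ A, ∀ t ∈ B, s ⊆ t → t ∈ A) (d : ℕ) :
    cocycles 𝔽 A d ≤ (cocycles 𝔽 B d).comap (incl 𝔽 A B d) := by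
  intro c hc
  have hcomm := LinearMap.congr_fun (incl_cobdry_comm 𝔽 A B hAB hA d) c
  simp only [LinearMap.comp_apply] at hcomm
  simp only [cocycles, Submodule.mem_comap, LinearMap.mem_ker] at hc ⊢
  rw [hcomm, hc, map_zero]

lemma coboundsLe {A B : Finset (Finset V)} (hAB : A ⊆ B)
    (hA : ∀ s ∈ A, ∀ t ∈ B, s ⊆ t → t ∈ A) (d : ℕ) :
    cobounds 𝔽 A d ≤ (cobounds 𝔽 B d).comap (incl 𝔽 A B d) := by
  cases d with
  | zero => simp [cobounds]
  | succ d =>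
    rintro c ⟨x, rfl⟩
    have hcomm := LinearMap.congr_fun (incl_cobdry_comm 𝔽 A B hAB hA d) x
    simp only [LinearMap.comp_apply] at hcomm
    exact Submodule.mem_comap.2 ⟨incl 𝔽 A B d x, hcomm⟩

/-- Simplicial homology of `A` in degree `d`: `H_d(A) = Z_d(A)/B_d(A)`. -/
abbrev homologyM (A : Finset (Finset V)) (d : ℕ) :=
  ↥(cycles 𝔽 A d) ⧸ ((bounds 𝔽 A d).comap (cycles 𝔽 A d).subtype)

/-- The map `H_d(A) → H_d(B)` induced on homology by the inclusion of chains. -/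
noncomputable def inducedH {A B : Finset (Finset V)} {d : ℕ}
    (hZ : cycles 𝔽 A d ≤ (cycles 𝔽 B d).comap (incl 𝔽 A B d))
    (hB : bounds 𝔽 A d ≤ (bounds 𝔽 B d).comap (incl 𝔽 A B d)) :
    homologyM 𝔽 A d →ₗ[𝔽] homologyM 𝔽 B d :=
  Submodule.mapQ _ _ ((incl 𝔽 A B d).restrict (fun c hc => hZ hc))
    (fun z hz => hB hz)


lemma incl_injective {A B : Finset (Finset V)} (hAB : A ⊆ B) (d : ℕ) :
    Function.Injective (incl 𝔽 A B d) := by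
  intro c c' h
  funext σ
  have hσ : σ.1 ∈ dsimp B d := mem_dsimp.2 ⟨hAB (mem_dsimp.1 σ.2).1, (mem_dsimp.1 σ.2).2⟩
  have := congrFun h ⟨σ.1, hσ⟩
  rw [incl_apply, incl_apply, dif_pos σ.2, dif_pos σ.2] at this
  exact this

lemma finrank_map_mkQ {M : Type*} [AddCommGroup M] [Module 𝔽 M] [FiniteDimensional 𝔽 M]
    (p S : Submodule 𝔽 M) (h : p ≤ S) :
    Module.finrank 𝔽 ↥(S.map p.mkQ) + Module.finrank 𝔽 p = Module.finrank 𝔽 S := by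
  have h1 := LinearMap.finrank_range_add_finrank_ker (p.mkQ.domRestrict S)
  rw [LinearMap.range_domRestrict, LinearMap.ker_domRestrict, Submodule.ker_mkQ] at h1
  rw [← h1]
  congr 1
  exact (Submodule.comapSubtypeEquivOfLe h).finrank_eq.symm

lemma finrank_ker_inducedH {A B : Finset (Finset V)} {d : ℕ} (hAB : A ⊆ B)
    (hZ : cycles 𝔽 A d ≤ (cycles 𝔽 B d).comap (incl 𝔽 A B d))
    (hB : bounds 𝔽 A d ≤ (bounds 𝔽 B d).comap (incl 𝔽 A B d)) :
    Module.finrank 𝔽 ↥(LinearMap.ker (inducedH 𝔽 hZ hB)) +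
      Module.finrank 𝔽 ↥((bounds 𝔽 A d).comap (cycles 𝔽 A d).subtype) =
    Module.finrank 𝔽 ↥((cycles 𝔽 A d).map (incl 𝔽 A B d) ⊓ bounds 𝔽 B d) := by
  have hk : LinearMap.ker (inducedH 𝔽 hZ hB) =
      (((bounds 𝔽 B d).comap (incl 𝔽 A B d)).comap (cycles 𝔽 A d).subtype).map
        (((bounds 𝔽 A d).comap (cycles 𝔽 A d).subtype).mkQ) := by
    exact Submodule.ker_mapQ _ _ _ _
  rw [hk, finrank_map_mkQ _ _ _ (Submodule.comap_mono hB)]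
  have hi : Function.Injective ((incl 𝔽 A B d).comp (cycles 𝔽 A d).subtype) :=
    (incl_injective 𝔽 hAB d).comp Subtype.val_injective
  rw [(Submodule.equivMapOfInjective _ hi
    (((bounds 𝔽 B d).comap (incl 𝔽 A B d)).comap (cycles 𝔽 A d).subtype)).finrank_eq]
  have he : (((bounds 𝔽 B d).comap (incl 𝔽 A B d)).comap (cycles 𝔽 A d).subtype).map
      ((incl 𝔽 A B d).comp (cycles 𝔽 A d).subtype) =
      (cycles 𝔽 A d).map (incl 𝔽 A B d) ⊓ bounds 𝔽 B d := by
    ext x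
    constructor
    · rintro ⟨z, hz, rfl⟩
      exact ⟨⟨z.1, z.2, rfl⟩, hz⟩
    · rintro ⟨⟨z, hz, rfl⟩, hx⟩
      exact ⟨⟨z, hz⟩, hx, rfl⟩
  rw [he]

lemma offdiag_zero {P : Type*} [PartialOrder P] [Fintype P] (D : Itv P → ℤ) (β : P → ℤ)
    (h : ∀ y : Itv P, (∑ x : Itv P, if x ≤ y then D x else 0) = β y.1.1) :
    ∀ I : Itv P, I.1.1 < I.1.2 → D I = 0 := by
  intro I
  induction I using WellFoundedLT.induction with
  | ind I ih =>
    intro hI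
    have e1 := h I
    have e2 := h ⟨(I.1.1, I.1.1), le_rfl⟩
    have e3 : (∑ x : Itv P, ((if x ≤ I then D x else 0) -
        (if x ≤ (⟨(I.1.1, I.1.1), le_rfl⟩ : Itv P) then D x else 0))) = 0 := by
      rw [Finset.sum_sub_distrib, e1, e2, sub_self]
    rw [Finset.sum_eq_single I] at e3
    · rw [if_pos le_rfl, if_neg, sub_zero] at e3
      · exact e3
      · intro hle
        exact absurd hle.2 (not_le_of_gt hI)
    · intro x _ hx
      by_cases hxI : x ≤ I
      · by_cases hxa : x ≤ (⟨(I.1.1, I.1.1), le_rfl⟩ : Itv P)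
        · rw [if_pos hxI, if_pos hxa, sub_self]
        · rw [if_pos hxI, if_neg hxa, sub_zero]
          refine ih x (lt_of_le_of_ne hxI hx) (lt_of_le_of_ne x.2 fun he => hxa ?_)
          exact ⟨hxI.1, he ▸ hxI.1⟩
      · rw [if_neg hxI, if_neg, sub_zero]
        intro hle
        exact hxI ⟨hle.1, hle.2.trans I.2⟩
    · simp

/-- The Möbius inversions of the birth-death function `BD_d F` and of the kernel
function `ker H_d F` of a filtration agree away from the diagonal. -/
theorem bd_equiv_ker_homology {P : Type*} [PartialOrder P] [Fintype P]
    (K : Finset (Finset V)) (hK : IsComplex K)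
    (F : P → Finset (Finset V)) (hFmono : Monotone F)
    (hFsub : ∀ a, IsSubcomplexOf K (F a))
    (d : ℕ) (dBD dker : Itv P → ℤ)
    (h1 : IsMobiusInv (BDh 𝔽 F d) dBD)
    (h2 : IsMobiusInv (fun I : Itv P =>
      (Module.finrank 𝔽 ↥(LinearMap.ker (inducedH 𝔽
        (cyclesLe 𝔽 (hFmono I.2) (hFsub I.1.1).2 d)
        (boundsLe 𝔽 (hFmono I.2) (hFsub I.1.1).2 d))) : ℤ)) dker) :
    ∀ I : Itv P, I.1.1 < I.1.2 → dBD I = dker I := by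
  intro I hI
  refine sub_eq_zero.1 (offdiag_zero (fun x => dBD x - dker x)
    (fun a => (Module.finrank 𝔽
      ↥((bounds 𝔽 (F a) d).comap (cycles 𝔽 (F a) d).subtype) : ℤ)) ?_ I hI)
  intro y
  have hy := finrank_ker_inducedH 𝔽 (hFmono y.2)
    (cyclesLe 𝔽 (hFmono y.2) (hFsub y.1.1).2 d)
    (boundsLe 𝔽 (hFmono y.2) (hFsub y.1.1).2 d)
  have e : (∑ x : Itv P, if x ≤ y then dBD x - dker x else 0) =
      (∑ x : Itv P, if x ≤ y then dBD x else 0) - ∑ x : Itv P, if x ≤ y then dker x else 0 := by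
    rw [← Finset.sum_sub_distrib]
    refine Finset.sum_congr rfl fun x _ => ?_
    split_ifs <;> simp
  have a1 : BDh 𝔽 F d y = ∑ x : Itv P, if x ≤ y then dBD x else 0 := by
    convert h1 y
  have a2 : (Module.finrank 𝔽 ↥(LinearMap.ker (inducedH 𝔽
      (cyclesLe 𝔽 (hFmono y.2) (hFsub y.1.1).2 d)
      (boundsLe 𝔽 (hFmono y.2) (hFsub y.1.1).2 d))) : ℤ) =
      ∑ x : Itv P, if x ≤ y then dker x else 0 := by
    convert h2 y
  rw [e, ← a1, ← a2, BDh, ← hy]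
  push_cast
  ring
end

section
/- Let M be a persistence module indexed by a finite poset P and N a persistence module indexed by a finite poset Q, both with finite-dimensional values over a field 𝔽, and let f : M ⇄ N : g be a module morphism (a Galois connection f : P ⇄ Q : g with N = M ∘ g). If φ is a presentation of M and ψ is a presentation of N, then ∂BD ψ and (Int f)_♯ ∂BD φ agree away from the diagonal: ∂BD ψ [x,y] = ((Int f)_♯ ∂BD φ)[x,y] for all x < y in Q. -/
set_option linter.unusedSectionVars false
set_option linter.unusedVariables false

open Classical

/-- A persistence module over a poset `P`: a functor `P → Vect_𝔽` with
finite-dimensional values. -/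
structure PersMod (𝔽 : Type*) [Field 𝔽] (P : Type*) [PartialOrder P] where
  V : P → Type*
  [acg : ∀ a, AddCommGroup (V a)]
  [mod : ∀ a, Module 𝔽 (V a)]
  [fd : ∀ a, FiniteDimensional 𝔽 (V a)]
  map : ∀ {a b : P}, a ≤ b → (V a →ₗ[𝔽] V b)
  map_id : ∀ a : P, map (le_refl a) = LinearMap.id
  map_comp : ∀ {a b c : P} (h₁ : a ≤ b) (h₂ : b ≤ c), map (h₁.trans h₂) = (map h₂).comp (map h₁)

attribute [instance] PersMod.acg PersMod.mod PersMod.fd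

variable {𝔽 : Type*} [Field 𝔽] {P Q : Type*} [PartialOrder P] [PartialOrder Q]

/-- The value at `a` of the free module on generators `gen : ι → P`, realized as the
subspace of `ι → 𝔽` of vectors supported on `{j : gen j ≤ a}`.  This realizes
`⨁ⱼ 𝔽^{↑ gen j}` evaluated at `a`, with structure maps the subspace inclusions. -/
def Fsub (𝔽 : Type*) [Field 𝔽] {P : Type*} [PartialOrder P] {ι : Type*} (gen : ι → P)
    (a : P) : Submodule 𝔽 (ι → 𝔽) where
  carrier := {c | ∀ j, ¬ gen j ≤ a → c j = 0}
  add_mem' := fun {x y} hx hy j hj => by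
    simp only [Pi.add_apply, hx j hj, hy j hj, add_zero]
  zero_mem' := fun j _ => rfl
  smul_mem' := fun r {x} hx j hj => by
    simp only [Pi.smul_apply, hx j hj, smul_zero]

lemma Fsub_mono (𝔽 : Type*) [Field 𝔽] {P : Type*} [PartialOrder P] {ι : Type*}
    (gen : ι → P) {a b : P} (h : a ≤ b) : Fsub 𝔽 gen a ≤ Fsub 𝔽 gen b :=
  fun _ hc j hj => hc j fun h' => hj (h'.trans h)

/-- A presentation of `M`: a surjective natural transformation from a (finitely generated)
free module, given by generators `gen : ι → P`. -/
structure FreePres {𝔽 : Type*} [Field 𝔽] {P : Type*} [PartialOrder P] (M : PersMod 𝔽 P) where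
  ι : Type
  [fin : Fintype ι]
  gen : ι → P
  pr : ∀ a : P, ↥(Fsub 𝔽 gen a) →ₗ[𝔽] M.V a
  surj : ∀ a, Function.Surjective (pr a)
  natural : ∀ {a b : P} (h : a ≤ b),
    (M.map h).comp (pr a) = (pr b).comp (Submodule.inclusion (Fsub_mono 𝔽 gen h))

attribute [instance] FreePres.fin

/-- Birth-death function of a presentation: `BD φ [a,b] = dim (F(a) ∩ ker φ_b)`,
where `F(a)` is viewed inside `F(b)`. -/
noncomputable def BDpres {𝔽 : Type*} [Field 𝔽] {P : Type*} [PartialOrder P]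
    {M : PersMod 𝔽 P} (pres : FreePres M) (I : Itv P) : ℤ :=
  Module.finrank 𝔽
    ↥((Fsub 𝔽 pres.gen I.1.1).comap (Fsub 𝔽 pres.gen I.1.2).subtype
      ⊓ LinearMap.ker (pres.pr I.1.2))

/-- Kernel function of a persistence module: `ker M [a,b] = dim ker (M(a) → M(b))`. -/
noncomputable def kerFun {𝔽 : Type*} [Field 𝔽] {P : Type*} [PartialOrder P]
    (M : PersMod 𝔽 P) (I : Itv P) : ℤ :=
  Module.finrank 𝔽 ↥(LinearMap.ker (M.map I.2))

/-- Pullback of a persistence module along a monotone map, `(M ∘ g)(x) = M(g x)`. -/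
def PersMod.pullback (M : PersMod 𝔽 P) (g : Q → P) (hg : Monotone g) : PersMod 𝔽 Q where
  V x := M.V (g x)
  map h := M.map (hg h)
  map_id x := M.map_id (g x)
  map_comp h₁ h₂ := M.map_comp (hg h₁) (hg h₂)




lemma finrank_Fsub_aux (𝔽 : Type*) [Field 𝔽] {P : Type*} [PartialOrder P] {ι : Type*} [Fintype ι]
    (gen : ι → P) (a : P) :
    Module.finrank 𝔽 (Fsub 𝔽 gen a) = Fintype.card {j // gen j ≤ a} := by
  let e : (Fsub 𝔽 gen a) ≃ₗ[𝔽] ({j // gen j ≤ a} → 𝔽) :=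
    { toFun := fun c j => c.1 j.1
      map_add' := fun _ _ => rfl
      map_smul' := fun _ _ => rfl
      invFun := fun d => ⟨fun j => if h : gen j ≤ a then d ⟨j, h⟩ else 0,
        fun j hj => dif_neg hj⟩
      left_inv := fun c => by
        apply Subtype.ext
        funext j
        by_cases h : gen j ≤ a
        · simp [h]
        · simp only [h, dite_false]
          exact (c.2 j h).symm
      right_inv := fun d => by
        funext j
        simp [j.2] }
  rw [e.finrank_eq, Module.finrank_fintype_fun_eq_card]

lemma BDpres_eq_aux {𝔽 : Type*} [Field 𝔽] {P : Type*} [PartialOrder P]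
    {M : PersMod 𝔽 P} (pres : FreePres M) (I : Itv P) :
    BDpres pres I = (Fintype.card {j // pres.gen j ≤ I.1.1} : ℤ)
      - Module.finrank 𝔽 (LinearMap.range (M.map I.2)) := by
  have hr := LinearMap.finrank_range_add_finrank_ker ((M.map I.2).comp (pres.pr I.1.1))
  rw [finrank_Fsub_aux, LinearMap.range_comp_of_range_eq_top _
    (LinearMap.range_eq_top.2 (pres.surj _))] at hr
  have hk : Module.finrank 𝔽 (LinearMap.ker ((M.map I.2).comp (pres.pr I.1.1)))
      = Module.finrank 𝔽 ↥((Fsub 𝔽 pres.gen I.1.1).comap (Fsub 𝔽 pres.gen I.1.2).subtype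
      ⊓ LinearMap.ker (pres.pr I.1.2)) := by
    have hm : (LinearMap.ker ((M.map I.2).comp (pres.pr I.1.1))).map
        (Submodule.inclusion (Fsub_mono 𝔽 pres.gen I.2)) =
        ((Fsub 𝔽 pres.gen I.1.1).comap (Fsub 𝔽 pres.gen I.1.2).subtype
      ⊓ LinearMap.ker (pres.pr I.1.2)) := by
      rw [pres.natural I.2]
      ext c
      simp only [Submodule.mem_map, LinearMap.mem_ker, LinearMap.comp_apply, Submodule.mem_inf,
        Submodule.mem_comap]
      constructor
      · rintro ⟨y, hy, rfl⟩
        exact ⟨y.2, hy⟩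
      · rintro ⟨h, h'⟩
        exact ⟨⟨c.1, h⟩, h', rfl⟩
    rw [← hm]
    exact (Submodule.equivMapOfInjective _ (Submodule.inclusion_injective _) _).finrank_eq
  unfold BDpres
  rw [← hk]
  omega

lemma mobius_unique_aux {R : Type*} [PartialOrder R] [Fintype R] {m d e : R → ℤ}
    (hd : IsMobiusInv m d) (he : IsMobiusInv m e) : d = e := by
  funext y
  induction y using WellFoundedLT.induction with
  | ind y ih =>
    have h := (hd y).symm.trans (he y)
    rw [← Finset.add_sum_erase _ _ (Finset.mem_univ y),
      ← Finset.add_sum_erase _ _ (Finset.mem_univ y)] at h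
    have h2 : ∑ x ∈ Finset.univ.erase y, (if x ≤ y then d x else 0)
        = ∑ x ∈ Finset.univ.erase y, (if x ≤ y then e x else 0) := by
      refine Finset.sum_congr rfl fun x hx => ?_
      split_ifs with hxy
      · exact ih x (lt_of_le_of_ne hxy (Finset.ne_of_mem_erase hx))
      · rfl
    rw [h2] at h
    rw [if_pos le_rfl, if_pos le_rfl] at h
    exact add_right_cancel h

/-- Sum over fibres. -/
lemma sum_fib_aux {R S : Type*} [PartialOrder R] [DecidableEq R] [Fintype R] [Fintype S] (k : S → R)
    (w : S → ℤ) (y : R) :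
    (∑ x : R, if x ≤ y then ∑ s : S, (if k s = x then w s else 0) else 0)
      = ∑ s : S, if k s ≤ y then w s else 0 := by
  have : ∀ x : R, (if x ≤ y then ∑ s : S, (if k s = x then w s else 0) else 0)
      = ∑ s : S, if k s = x then (if x ≤ y then w s else 0) else 0 := by
    intro x
    split_ifs with h
    · rfl
    · simp
  simp_rw [this]
  rw [Finset.sum_comm]
  simp

lemma sum_split_aux {R : Type*} [PartialOrder R] [Fintype R] (I : R) (A B C : R → ℤ) :
    (∑ x : R, if x ≤ I then A x + (B x - C x) else 0)
        = (∑ x : R, if x ≤ I then A x else 0) + ((∑ x : R, if x ≤ I then B x else 0)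
          - (∑ x : R, if x ≤ I then C x else 0)) := by
  rw [← Finset.sum_sub_distrib, ← Finset.sum_add_distrib]
  refine Finset.sum_congr rfl fun x _ => ?_
  split_ifs <;> simp

lemma card_diag_aux {Q : Type*} [PartialOrder Q] {ι : Type*} [Fintype ι] (k : ι → Q) (I : Itv Q) :
    (∑ j : ι, @ite _ ((⟨(k j, k j), le_refl _⟩ : Itv Q) ≤ I) (Classical.propDecidable _) (1 : ℤ) 0)
      = Fintype.card {j // k j ≤ I.1.1} := by
  rw [Fintype.card_subtype, Finset.card_filter]
  push_cast
  refine Finset.sum_congr rfl fun j _ => ?_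
  have : ((⟨(k j, k j), le_refl _⟩ : Itv Q) ≤ I) ↔ k j ≤ I.1.1 :=
    ⟨fun h => h.1, fun h => ⟨h, h.trans I.2⟩⟩
  simp only [this]

/-- If `f : M ⇄ N : g` is a module morphism (so `N = M ∘ g`), `φ` a presentation of `M`
and `ψ` a presentation of `N`, then `∂BD ψ` and `(Int f)_♯ ∂BD φ` agree away from the
diagonal. -/
theorem dgm_pushforward_presentations {𝔽 : Type*} [Field 𝔽] {P Q : Type*}
    [PartialOrder P] [PartialOrder Q] [Fintype P] [Fintype Q]
    (M : PersMod 𝔽 P) (f : P → Q) (g : Q → P) (hgc : GaloisConnection f g)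
    (pres : FreePres M) (pres' : FreePres (M.pullback g hgc.monotone_u))
    (dφ : Itv P → ℤ) (dψ : Itv Q → ℤ)
    (h1 : IsMobiusInv (BDpres pres) dφ) (h2 : IsMobiusInv (BDpres pres') dψ) :
    ∀ I : Itv Q, I.1.1 < I.1.2 →
      dψ I = ∑ J : Itv P,
        if (⟨(f J.1.1, f J.1.2), hgc.monotone_l J.2⟩ : Itv Q) = I then dφ J else 0 := by
  have key : IsMobiusInv (BDpres pres') (fun I =>
      (∑ J : Itv P, if (⟨(f J.1.1, f J.1.2), hgc.monotone_l J.2⟩ : Itv Q) = I then dφ J else 0)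
      + ((∑ j : pres'.ι, if (⟨(pres'.gen j, pres'.gen j), le_refl _⟩ : Itv Q) = I
          then (1 : ℤ) else 0)
        - (∑ j : pres.ι, if (⟨(f (pres.gen j), f (pres.gen j)), le_refl _⟩ : Itv Q) = I
          then (1 : ℤ) else 0))) := by
    intro I
    beta_reduce
    rw [sum_split_aux, sum_fib_aux (fun J : Itv P => (⟨(f J.1.1, f J.1.2), hgc.monotone_l J.2⟩ : Itv Q)),
      sum_fib_aux (fun j => (⟨(pres'.gen j, pres'.gen j), le_refl _⟩ : Itv Q)),
      sum_fib_aux (fun j => (⟨(f (pres.gen j), f (pres.gen j)), le_refl _⟩ : Itv Q)),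
      card_diag_aux, card_diag_aux (fun j => f (pres.gen j)), BDpres_eq_aux]
    have h3 := h1 ⟨(g I.1.1, g I.1.2), hgc.monotone_u I.2⟩
    rw [BDpres_eq_aux] at h3
    have h4 : (∑ J : Itv P, @ite _ ((⟨(f J.1.1, f J.1.2), hgc.monotone_l J.2⟩ : Itv Q) ≤ I)
        (Classical.propDecidable _) (dφ J) 0) = ∑ J : Itv P,
        @ite _ (J ≤ (⟨(g I.1.1, g I.1.2), hgc.monotone_u I.2⟩ : Itv P))
        (Classical.propDecidable _) (dφ J) 0 := by
      refine Finset.sum_congr rfl fun J _ => ?_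
      have : (⟨(f J.1.1, f J.1.2), hgc.monotone_l J.2⟩ : Itv Q) ≤ I ↔
          J ≤ (⟨(g I.1.1, g I.1.2), hgc.monotone_u I.2⟩ : Itv P) :=
        and_congr (hgc _ _) (hgc _ _)
      exact @if_congr _ _ _ (_) (_) _ _ _ _ this rfl rfl
    have h5 : Fintype.card {j // f (pres.gen j) ≤ I.1.1}
        = Fintype.card {j // pres.gen j ≤ g I.1.1} :=
      Fintype.card_congr (Equiv.subtypeEquivRight fun j => hgc _ _)
    rw [h4, ← h3, h5]
    change _ - (Module.finrank 𝔽 (LinearMap.range (M.map (hgc.monotone_u I.2))) : ℤ) = _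
    ring
  intro I hI
  rw [mobius_unique_aux h2 key]
  have hne : ∀ z : Q, (⟨(z, z), le_refl _⟩ : Itv Q) ≠ I := by
    rintro z rfl
    exact lt_irrefl _ hI
  simp [hne]
end

section
/- Let M be a persistence module indexed by a finite poset P with finite-dimensional values over a field 𝔽, and let φ : F ⇒ M be any presentation of M. Then the Möbius inversion of the birth-death function of φ agrees with the Möbius inversion of the kernel function of M away from the diagonal: ∂BD φ [a,b] = ∂(ker M)[a,b] for all a < b in P. -/
set_option linter.unusedSectionVars false
set_option linter.unusedVariables false

open Classical

variable {𝔽 : Type*} [Field 𝔽] {P Q : Type*} [PartialOrder P] [PartialOrder Q]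

/-- Rank computation: `BD φ [a,b] = ker M [a,b] + dim ker φ_a`. -/
lemma BDpres_eq {𝔽 : Type*} [Field 𝔽] {P : Type*} [PartialOrder P]
    (M : PersMod 𝔽 P) (pres : FreePres M) (I : Itv P) :
    BDpres pres I = kerFun M I + (Module.finrank 𝔽 (LinearMap.ker (pres.pr I.1.1)) : ℤ) := by
  obtain ⟨⟨a, b⟩, h⟩ := I
  change a ≤ b at h
  have hS : ((Fsub 𝔽 pres.gen a).comap (Fsub 𝔽 pres.gen b).subtype
      ⊓ LinearMap.ker (pres.pr b)) =
      (LinearMap.ker ((M.map h).comp (pres.pr a))).map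
        (Submodule.inclusion (Fsub_mono 𝔽 pres.gen h)) := by
    rw [pres.natural h]
    ext x
    constructor
    · rintro ⟨hx, hk⟩
      exact ⟨⟨x.1, hx⟩, hk, rfl⟩
    · rintro ⟨y, hy, rfl⟩
      exact ⟨y.2, hy⟩
  have e1 : Module.finrank 𝔽 ↥((Fsub 𝔽 pres.gen a).comap (Fsub 𝔽 pres.gen b).subtype
      ⊓ LinearMap.ker (pres.pr b)) =
      Module.finrank 𝔽 (LinearMap.ker ((M.map h).comp (pres.pr a))) := by
    rw [hS]
    exact (Submodule.equivMapOfInjective _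
      (Submodule.inclusion_injective (Fsub_mono 𝔽 pres.gen h)) _).finrank_eq.symm
  have hr : LinearMap.range (pres.pr a) = ⊤ := LinearMap.range_eq_top.2 (pres.surj a)
  have r1 := LinearMap.finrank_range_add_finrank_ker ((M.map h).comp (pres.pr a))
  have r2 := LinearMap.finrank_range_add_finrank_ker (pres.pr a)
  have r3 := LinearMap.finrank_range_add_finrank_ker (M.map h)
  rw [LinearMap.range_comp_of_range_eq_top _ hr] at r1
  rw [hr, finrank_top] at r2
  simp only [BDpres, kerFun]
  rw [e1]
  omega

/-- A function on `Int P` whose down-set sums depend only on the left endpoint vanishes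
off the diagonal. -/
lemma off_diag_zero {P : Type*} [PartialOrder P] [Fintype P] (D : Itv P → ℤ) (g : P → ℤ)
    (hD : ∀ y : Itv P, ∑ x : Itv P, (if x ≤ y then D x else 0) = g y.1.1) :
    ∀ I : Itv P, I.1.1 < I.1.2 → D I = 0 := by
  intro I
  induction I using WellFoundedLT.induction with
  | ind I ih =>
    intro hI
    let J : Itv P := ⟨(I.1.1, I.1.1), le_refl _⟩
    have hJI : J ≤ I := ⟨le_refl _, I.2⟩
    have h0 : ∑ x : Itv P, ((if x ≤ I then D x else 0) - (if x ≤ J then D x else 0)) = 0 := by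
      rw [Finset.sum_sub_distrib, hD I, hD J, sub_self]
    rw [Finset.sum_eq_single I] at h0
    · have : ¬ I ≤ J := fun hh => absurd hh.2 (not_le_of_gt hI)
      simpa [this] using h0
    · intro x _ hx
      by_cases h1 : x ≤ J
      · simp [h1, h1.trans hJI]
      · by_cases h2 : x ≤ I
        · have h3 : x.1.1 < x.1.2 := by
            refine lt_of_le_of_ne x.2 fun he => h1 ⟨h2.1, ?_⟩
            rw [← he]
            exact h2.1
          simp [h1, h2, ih x (lt_of_le_of_ne h2 hx) h3]
        · simp [h1, h2]
    · simp

/-- For any presentation `φ` of a persistence module `M`, the Möbius inversion of the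
birth-death function `BD φ` agrees with the Möbius inversion of the kernel function
`ker M` away from the diagonal. -/
theorem bdpres_equiv_ker {𝔽 : Type*} [Field 𝔽] {P : Type*} [PartialOrder P] [Fintype P]
    (M : PersMod 𝔽 P) (pres : FreePres M) (dBD dker : Itv P → ℤ)
    (h1 : IsMobiusInv (BDpres pres) dBD) (h2 : IsMobiusInv (kerFun M) dker) :
    ∀ I : Itv P, I.1.1 < I.1.2 → dBD I = dker I := by
  intro I hI
  have key := off_diag_zero (fun x => dBD x - dker x)
    (fun a => (Module.finrank 𝔽 (LinearMap.ker (pres.pr a)) : ℤ)) (by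
      intro y
      have e := BDpres_eq M pres y
      rw [h1 y, h2 y] at e
      have : ∀ x : Itv P, (if x ≤ y then dBD x - dker x else 0) =
          (if x ≤ y then dBD x else 0) - (if x ≤ y then dker x else 0) := by
        intro x
        split_ifs <;> simp
      simp only [this, Finset.sum_sub_distrib]
      rw [sub_eq_iff_eq_add, add_comm]
      convert e) I hI
  exact sub_eq_zero.1 key
end

section
/- Let φ : F ⇒ M be a presentation of a persistence module M indexed by a finite poset P, and let f : M ⇄ N : g be a module morphism to a persistence module N indexed by a finite poset Q (so N = M ∘ g). Then ψ := φ ∘ g, with components ψ_x = φ_{g(x)} : F(g(x)) → N(x), is a presentation of N, and its birth-death function is the pullback of that of φ: BD ψ [x,y] = BD φ [g(x), g(y)] for all x ≤ y in Q. -/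
set_option linter.unusedSectionVars false
set_option linter.unusedVariables false

open Classical

variable {𝔽 : Type*} [Field 𝔽] {P Q : Type*} [PartialOrder P] [PartialOrder Q]

/-- The component at `x` of `ψ = φ ∘ g`, the pulled-back presentation of `M ∘ g`.
Its domain is the value at `x` of the free `Q`-module on generators `f ∘ gen`, which
coincides with the value of the free `P`-module on `gen` at `g x`. -/
noncomputable def pullPr {𝔽 : Type*} [Field 𝔽] {P Q : Type*} [PartialOrder P] [PartialOrder Q]
    {M : PersMod 𝔽 P} (pres : FreePres M) (f : P → Q) (g : Q → P)
    (hgc : GaloisConnection f g) (x : Q) :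
    ↥(Fsub 𝔽 (fun j => f (pres.gen j)) x) →ₗ[𝔽] M.V (g x) :=
  (pres.pr (g x)).comp (Submodule.inclusion fun c hc j hj =>
    hc j fun h' => hj ((hgc _ _).mp h'))


lemma Fsub_galois_eq (𝔽 : Type*) [Field 𝔽] {P Q : Type*} [PartialOrder P] [PartialOrder Q]
    {ι : Type*} (gen : ι → P) (f : P → Q) (g : Q → P) (hgc : GaloisConnection f g) (x : Q) :
    Fsub 𝔽 (fun j => f (gen j)) x = Fsub 𝔽 gen (g x) := by
  ext c
  constructor
  · intro hc j hj
    exact hc j fun h' => hj ((hgc _ _).mp h')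
  · intro hc j hj
    exact hc j fun h' => hj ((hgc _ _).mpr h')

lemma finrank_comap_inf_ker_eq {𝔽 : Type*} [Field 𝔽] {V W : Type*} [AddCommGroup V]
    [Module 𝔽 V] [AddCommGroup W] [Module 𝔽 W] {A A' B B' : Submodule 𝔽 V}
    (hA : A' = A) (hB : B' = B) (hle : B' ≤ B) (p : ↥B →ₗ[𝔽] W) :
    Module.finrank 𝔽 ↥(A'.comap B'.subtype ⊓ LinearMap.ker (p.comp (Submodule.inclusion hle)))
      = Module.finrank 𝔽 ↥(A.comap B.subtype ⊓ LinearMap.ker p) := by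
  subst hA hB
  rfl

/-- `ψ := φ ∘ g` is a presentation of the pullback module `N = M ∘ g`
(its free module is the free `Q`-module on generators `f ∘ gen`): it is surjective
and natural; moreover its birth-death function is the pullback of that of `φ`:
`BD ψ [x,y] = BD φ [g x, g y]`. -/
theorem pullback_presentation {𝔽 : Type*} [Field 𝔽] {P Q : Type*}
    [PartialOrder P] [PartialOrder Q]
    (M : PersMod 𝔽 P) (pres : FreePres M) (f : P → Q) (g : Q → P)
    (hgc : GaloisConnection f g) :
    (∀ x : Q, Function.Surjective (pullPr pres f g hgc x))
    ∧ (∀ x y : Q, ∀ h : x ≤ y,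
        ((M.pullback g hgc.monotone_u).map h).comp (pullPr pres f g hgc x)
          = (pullPr pres f g hgc y).comp
              (Submodule.inclusion (Fsub_mono 𝔽 (fun j => f (pres.gen j)) h)))
    ∧ (∀ x y : Q, ∀ h : x ≤ y,
        (Module.finrank 𝔽
          ↥((Fsub 𝔽 (fun j => f (pres.gen j)) x).comap
              (Fsub 𝔽 (fun j => f (pres.gen j)) y).subtype
            ⊓ LinearMap.ker (pullPr pres f g hgc y)) : ℤ)
          = BDpres pres ⟨(g x, g y), hgc.monotone_u h⟩) := by
  refine ⟨fun x m => ?_, fun x y h => ?_, fun x y h => ?_⟩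
  · obtain ⟨c, hc⟩ := pres.surj (g x) m
    exact ⟨⟨c.1, (Fsub_galois_eq 𝔽 pres.gen f g hgc x).ge c.2⟩, hc⟩
  · ext c
    exact LinearMap.congr_fun (pres.natural (hgc.monotone_u h))
      ⟨c.1, (Fsub_galois_eq 𝔽 pres.gen f g hgc x).le c.2⟩
  · unfold BDpres pullPr
    exact congrArg Nat.cast (finrank_comap_inf_ker_eq (Fsub_galois_eq 𝔽 pres.gen f g hgc x)
      (Fsub_galois_eq 𝔽 pres.gen f g hgc y) _ (pres.pr (g y)))
end

section
/- Let K be a finite simplicial complex, 𝔽 a field, and let f : F ⇄ G : g be a filtration-preserving morphism between filtrations F : P → ΔK and G : Q → ΔK indexed by finite posets (i.e., a Galois connection f : P ⇄ Q : g with G = F ∘ g). Then for every d, the d-th persistent homology diagram of G is the pushforward of that of F: ∂BD_d G = (Int f)_♯ (∂BD_d F), i.e., for every interval I in Int Q, ∂BD_d G(I) = Σ_{J ∈ (Int f)⁻¹(I)} ∂BD_d F(J), with the empty sum interpreted as 0. -/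
set_option linter.unusedSectionVars false
set_option linter.unusedVariables false

open Classical

variable {V : Type*} [LinearOrder V]

variable (𝔽 : Type*) [Field 𝔽]

/-- Möbius inversions are unique. -/
theorem IsMobiusInv.unique {R : Type*} [PartialOrder R] [Fintype R] {m a b : R → ℤ}
    (ha : IsMobiusInv m a) (hb : IsMobiusInv m b) : a = b := by
  funext y
  induction y using (Finite.to_wellFoundedLT (α := R)).wf.induction with
  | _ y ih =>
    have h : (∑ x : R, if x ≤ y then a x else 0) = ∑ x : R, if x ≤ y then b x else 0 := by
      rw [← ha y, ← hb y]
    rw [← Finset.add_sum_erase _ _ (Finset.mem_univ y),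
      ← Finset.add_sum_erase _ _ (Finset.mem_univ y)] at h
    have h2 : (∑ x ∈ Finset.univ.erase y, if x ≤ y then a x else 0) =
        ∑ x ∈ Finset.univ.erase y, if x ≤ y then b x else 0 := by
      refine Finset.sum_congr rfl fun x hx => ?_
      split_ifs with hxy
      · exact ih x (lt_of_le_of_ne hxy (Finset.ne_of_mem_erase hx))
      · rfl
    rw [h2] at h
    rw [if_pos le_rfl, if_pos le_rfl] at h
    exact add_right_cancel h

/-- If `f : F ⇄ G : g` is a filtration-preserving morphism (`G = F ∘ g`), then the
persistent homology diagram of `G` is the pushforward of that of `F`: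
`∂BD_d G = (Int f)_♯ (∂BD_d F)`. -/
theorem dgm_filtration_pushforward {P Q : Type*} [PartialOrder P] [PartialOrder Q]
    [Fintype P] [Fintype Q]
    (K : Finset (Finset V)) (hK : IsComplex K)
    (F : P → Finset (Finset V)) (hFmono : Monotone F)
    (hFsub : ∀ a, IsSubcomplexOf K (F a))
    (G : Q → Finset (Finset V)) (hGmono : Monotone G)
    (hGsub : ∀ x, IsSubcomplexOf K (G x))
    (f : P → Q) (g : Q → P) (hgc : GaloisConnection f g)
    (hFG : ∀ x, G x = F (g x)) (d : ℕ)
    (dF : Itv P → ℤ) (dG : Itv Q → ℤ)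
    (hdF : IsMobiusInv (BDh 𝔽 F d) dF) (hdG : IsMobiusInv (BDh 𝔽 G d) dG) :
    ∀ I : Itv Q, dG I = ∑ J : Itv P,
      if (⟨(f J.1.1, f J.1.2), hgc.monotone_l J.2⟩ : Itv Q) = I then dF J else 0 := by
  obtain rfl : G = fun x => F (g x) := funext hFG
  intro I
  refine congrFun (IsMobiusInv.unique (b := fun I => ∑ J : Itv P,
    if (⟨(f J.1.1, f J.1.2), hgc.monotone_l J.2⟩ : Itv Q) = I then dF J else 0) hdG ?_) I
  intro y
  have h := hdF ⟨(g y.1.1, g y.1.2), hgc.monotone_u y.2⟩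
  refine Eq.trans (show _ = _ from h) ?_
  have e : ∀ x : Itv Q, (if x ≤ y then ∑ J : Itv P,
      (if (⟨(f J.1.1, f J.1.2), hgc.monotone_l J.2⟩ : Itv Q) = x then dF J else 0) else 0) =
      ∑ J : Itv P, if (⟨(f J.1.1, f J.1.2), hgc.monotone_l J.2⟩ : Itv Q) = x then
        (if x ≤ y then dF J else 0) else 0 := by
    intro x
    by_cases hx : x ≤ y <;> simp [hx]
  refine Eq.trans ?_ (Finset.sum_congr rfl fun x _ => Eq.trans (by congr) (e x)).symm
  rw [Finset.sum_comm]
  refine Finset.sum_congr rfl fun J _ => ?_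
  rw [Finset.sum_ite_eq, if_pos (Finset.mem_univ _)]
  have hiff : J ≤ (⟨(g y.1.1, g y.1.2), hgc.monotone_u y.2⟩ : Itv P) ↔
      (⟨(f J.1.1, f J.1.2), hgc.monotone_l J.2⟩ : Itv Q) ≤ y :=
    and_congr (hgc _ _).symm (hgc _ _).symm
  by_cases hJ : J ≤ (⟨(g y.1.1, g y.1.2), hgc.monotone_u y.2⟩ : Itv P)
  · rw [if_pos hJ, if_pos (hiff.1 hJ)]
  · rw [if_neg hJ, if_neg fun h' => hJ (hiff.2 h')]
end

section
/- Let K be a finite simplicial complex, 𝔽 a field, and let f : F ⇄ G : g be a cofiltration-preserving morphism between cofiltrations F : P → ∇K and G : Q → ∇K indexed by finite posets (i.e., a Galois connection f : P ⇄ Q : g with G = F ∘ g). Then for every d, the d-th persistent cohomology diagram of G is the pushforward of that of F: ∂BD^d G = (Int f)_♯ (∂BD^d F), i.e., for every interval I in Int Q, ∂BD^d G(I) = Σ_{J ∈ (Int f)⁻¹(I)} ∂BD^d F(J), with the empty sum interpreted as 0. -/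
set_option linter.unusedSectionVars false
set_option linter.unusedVariables false

open Classical

variable {V : Type*} [LinearOrder V]

variable (𝔽 : Type*) [Field 𝔽]

theorem mobius_unique_aux_s11 {R : Type*} [PartialOrder R] [Fintype R] (m a b : R → ℤ)
    (ha : IsMobiusInv m a) (hb : IsMobiusInv m b) (y : R) : a y = b y := by
  induction y using WellFoundedLT.induction with
  | ind y ih =>
    have h1 : (∑ x : R, if x ≤ y then a x else 0) = ∑ x : R, if x ≤ y then b x else 0 := by
      rw [← ha y, ← hb y]
    rw [← Finset.add_sum_erase _ _ (Finset.mem_univ y),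
      ← Finset.add_sum_erase (Finset.univ) (fun x => if x ≤ y then b x else 0)
        (Finset.mem_univ y)] at h1
    have h2 : (∑ x ∈ Finset.univ.erase y, if x ≤ y then a x else 0)
        = ∑ x ∈ Finset.univ.erase y, if x ≤ y then b x else 0 := by
      refine Finset.sum_congr rfl fun x hx => ?_
      split_ifs with h
      · exact ih x (lt_of_le_of_ne h (Finset.ne_of_mem_erase hx))
      · rfl
    rw [h2] at h1
    have h3 := add_right_cancel h1
    rwa [if_pos le_rfl, if_pos le_rfl] at h3

/-- If `f : F ⇄ G : g` is a cofiltration-preserving morphism (`G = F ∘ g`), then the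
persistent cohomology diagram of `G` is the pushforward of that of `F`:
`∂BD^d G = (Int f)_♯ (∂BD^d F)`. -/
theorem dgm_cofiltration_pushforward {P Q : Type*} [PartialOrder P] [PartialOrder Q]
    [Fintype P] [Fintype Q]
    (K : Finset (Finset V)) (hK : IsComplex K)
    (F : P → Finset (Finset V)) (hFmono : Monotone F)
    (hFsup : ∀ a, IsSupcomplexOf K (F a))
    (G : Q → Finset (Finset V)) (hGmono : Monotone G)
    (hGsup : ∀ x, IsSupcomplexOf K (G x))
    (f : P → Q) (g : Q → P) (hgc : GaloisConnection f g)
    (hFG : ∀ x, G x = F (g x)) (d : ℕ)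
    (dF : Itv P → ℤ) (dG : Itv Q → ℤ)
    (hdF : IsMobiusInv (BDc 𝔽 F d) dF) (hdG : IsMobiusInv (BDc 𝔽 G d) dG) :
    ∀ I : Itv Q, dG I = ∑ J : Itv P,
      if (⟨(f J.1.1, f J.1.2), hgc.monotone_l J.2⟩ : Itv Q) = I then dF J else 0 := by
  intro I
  refine mobius_unique_aux_s11 _ _ (fun I => ∑ J : Itv P,
      if (⟨(f J.1.1, f J.1.2), hgc.monotone_l J.2⟩ : Itv Q) = I then dF J else 0) hdG ?_ I
  intro y
  have hG : G = fun x => F (g x) := funext hFG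
  have h1 : BDc 𝔽 G d y = BDc 𝔽 F d ⟨(g y.1.1, g y.1.2), hgc.monotone_u y.2⟩ := by
    subst hG
    rfl
  rw [h1, hdF]
  have h2 : ∀ x : Itv Q, (if x ≤ y then ∑ J : Itv P,
      (if (⟨(f J.1.1, f J.1.2), hgc.monotone_l J.2⟩ : Itv Q) = x then dF J else 0) else 0)
      = ∑ J : Itv P, if (⟨(f J.1.1, f J.1.2), hgc.monotone_l J.2⟩ : Itv Q) = x then
          (if x ≤ y then dF J else 0) else 0 := by
    intro x
    by_cases h : x ≤ y <;> simp [h]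
  refine Eq.trans ?_ (Finset.sum_congr rfl fun x _ => (h2 x).symm.trans (by split_ifs <;> rfl))
  rw [Finset.sum_comm]
  refine Finset.sum_congr rfl fun J _ => ?_
  rw [Finset.sum_ite_eq, if_pos (Finset.mem_univ _)]
  have h3 : J ≤ (⟨(g y.1.1, g y.1.2), hgc.monotone_u y.2⟩ : Itv P) ↔
      (⟨(f J.1.1, f J.1.2), hgc.monotone_l J.2⟩ : Itv Q) ≤ y :=
    and_congr (hgc _ _).symm (hgc _ _).symm
  by_cases h : J ≤ (⟨(g y.1.1, g y.1.2), hgc.monotone_u y.2⟩ : Itv P)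
  · rw [if_pos h, if_pos (h3.1 h)]
  · rw [if_neg h, if_neg fun h' => h (h3.2 h')]
end
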